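/- Suppose the weighted composition operator uC_φ is invertible on the Bloch space, φ is a parabolic automorphism with unique fixed point a ∈ ∂D, and u is in the disc algebra. Then the spectrum of uC_φ on the Bloch space is exactly the circle {λ ∈ ℂ : |λ| = |u(a)|}. -/

import Mathlib

open Complex Metric Set Filter MeasureTheory Finset

noncomputable section

/-- The open unit disc in ℂ. -/
def D1 : Set ℂ := Metric.ball 0 1

/-- Analytic (holomorphic) on the open unit disc. -/
def AnalyticOnD (f : ℂ → ℂ) : Prop := DifferentiableOn ℂ f D1

/-- Bloch seminorm. -/
def blochSemi (f : ℂ → ℂ) : ℝ := ⨆ z : D1, (1 - ‖(z : ℂ)‖ ^ 2) * ‖deriv f (z : ℂ)‖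

/-- Bloch norm. -/
def blochNorm (f : ℂ → ℂ) : ℝ := ‖f 0‖ + blochSemi f

/-- Membership in the Bloch space. -/
def InBloch (f : ℂ → ℂ) : Prop :=
  AnalyticOnD f ∧ ∃ C, ∀ z ∈ D1, (1 - ‖z‖ ^ 2) * ‖deriv f z‖ ≤ C

/-- Sup norm over the unit disc. -/
def supNormD (f : ℂ → ℂ) : ℝ := ⨆ z : D1, ‖f (z : ℂ)‖

/-- Weighted composition operator uC_φ. -/
def wco (u φ : ℂ → ℂ) (f : ℂ → ℂ) : ℂ → ℂ := fun z => u z * f (φ z)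

/-- Multiplication operator M_u. -/
def mult (u : ℂ → ℂ) (f : ℂ → ℂ) : ℂ → ℂ := fun z => u z * f z

/-- The weight u_{(n)} = ∏_{j=0}^{n-1} u ∘ φ_j. -/
def wprod (u φ : ℂ → ℂ) (n : ℕ) : ℂ → ℂ := fun z => ∏ j ∈ Finset.range n, u (φ^[j] z)

/-- Boundedness of an operator on the Bloch space. -/
def BddOnBloch (T : (ℂ → ℂ) → (ℂ → ℂ)) : Prop :=
  ∃ C, ∀ f, InBloch f → InBloch (T f) ∧ blochNorm (T f) ≤ C * blochNorm f

/-- Operator norm on the Bloch space. -/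
def opNormB (T : (ℂ → ℂ) → (ℂ → ℂ)) : ℝ :=
  sInf {C : ℝ | 0 ≤ C ∧ ∀ f, InBloch f → blochNorm (T f) ≤ C * blochNorm f}

/-- Invertibility of an operator on the Bloch space (bounded two-sided inverse). -/
def InvertibleOnBloch (T : (ℂ → ℂ) → (ℂ → ℂ)) : Prop :=
  BddOnBloch T ∧ ∃ S, BddOnBloch S ∧
    ∀ f, InBloch f → Set.EqOn (S (T f)) f D1 ∧ Set.EqOn (T (S f)) f D1

/-- Spectrum of an operator acting on the Bloch space. -/
def blochSpectrum (T : (ℂ → ℂ) → (ℂ → ℂ)) : Set ℂ :=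
  {lam | ¬ InvertibleOnBloch (fun f z => lam * f z - T f z)}

/-- Automorphism of the unit disc (Möbius form). -/
def IsDiscAuto (φ : ℂ → ℂ) : Prop :=
  ∃ lam a : ℂ, ‖lam‖ = 1 ∧ a ∈ D1 ∧ ∀ z, φ z = lam * (a - z) / (1 - (starRingEnd ℂ) a * z)

/-- Hyperbolic distance on the unit disc. -/
def hypDist (z w : ℂ) : ℝ :=
  (1 / 2) * Real.log ((1 + ‖(z - w) / (1 - (starRingEnd ℂ) z * w)‖) /
    (1 - ‖(z - w) / (1 - (starRingEnd ℂ) z * w)‖))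

/-- The disc algebra A(𝔻). -/
def InDiscAlgebra (u : ℂ → ℂ) : Prop :=
  ContinuousOn u (Metric.closedBall 0 1) ∧ AnalyticOnD u

/-- u is bounded away from zero on the unit disc. -/
def BoundedAwayFromZero (u : ℂ → ℂ) : Prop := ∃ δ > 0, ∀ z ∈ D1, δ ≤ ‖u z‖

/-- Parabolic automorphism with unique fixed point a on the unit circle (φ'(a)=1). -/
def IsParabolicAuto (φ : ℂ → ℂ) (a : ℂ) : Prop :=
  IsDiscAuto φ ∧ ‖a‖ = 1 ∧ φ a = a ∧ deriv φ a = 1 ∧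
    ∀ w, ‖w‖ ≤ 1 → φ w = w → w = a

/-- Hyperbolic automorphism with attractive fixed point a and repulsive fixed point b. -/
def IsHyperbolicAuto (φ : ℂ → ℂ) (a b : ℂ) : Prop :=
  IsDiscAuto φ ∧ ‖a‖ = 1 ∧ ‖b‖ = 1 ∧ a ≠ b ∧ φ a = a ∧ φ b = b ∧
    ∃ μ : ℝ, 0 < μ ∧ μ < 1 ∧ deriv φ a = (μ : ℂ)

/-- Square of the Dirichlet norm (normalized area measure on 𝔻). -/
def dirichletNormSq (f : ℂ → ℂ) : ℝ :=
  ‖f 0‖ ^ 2 + (1 / Real.pi) * ∫ z in D1, ‖deriv f z‖ ^ 2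

/-- Dirichlet norm. -/
def dirichletNorm (f : ℂ → ℂ) : ℝ := Real.sqrt (dirichletNormSq f)

/-- Membership in the Dirichlet space. -/
def InDirichlet (f : ℂ → ℂ) : Prop :=
  AnalyticOnD f ∧ MeasureTheory.IntegrableOn (fun z => ‖deriv f z‖ ^ 2) D1

/-- Boundedness of an operator on the Dirichlet space. -/
def BddOnDirichlet (T : (ℂ → ℂ) → (ℂ → ℂ)) : Prop :=
  ∃ C, ∀ f, InDirichlet f → InDirichlet (T f) ∧ dirichletNorm (T f) ≤ C * dirichletNorm f

/-- Operator norm on the Dirichlet space. -/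
def opNormDir (T : (ℂ → ℂ) → (ℂ → ℂ)) : ℝ :=
  sInf {C : ℝ | 0 ≤ C ∧ ∀ f, InDirichlet f → dirichletNorm (T f) ≤ C * dirichletNorm f}

/-- Invertibility of an operator on the Dirichlet space. -/
def InvertibleOnDirichlet (T : (ℂ → ℂ) → (ℂ → ℂ)) : Prop :=
  BddOnDirichlet T ∧ ∃ S, BddOnDirichlet S ∧
    ∀ f, InDirichlet f → Set.EqOn (S (T f)) f D1 ∧ Set.EqOn (T (S f)) f D1

/-- Spectrum of an operator on the Dirichlet space. -/
def dirichletSpectrum (T : (ℂ → ℂ) → (ℂ → ℂ)) : Set ℂ :=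
  {lam | ¬ InvertibleOnDirichlet (fun f z => lam * f z - T f z)}

/-- Operator norm of M_{u'} : B → H^∞_{v₁}. -/
def opNormBtoHv1 (u : ℂ → ℂ) : ℝ :=
  sInf {C : ℝ | 0 ≤ C ∧ ∀ f, InBloch f → ∀ z ∈ D1,
    (1 - ‖z‖ ^ 2) * ‖deriv u z * f z‖ ≤ C * blochNorm f}

/-- Operator norm of M_{u'} : 𝒟 → A². -/
def opNormDtoA2 (u : ℂ → ℂ) : ℝ :=
  sInf {C : ℝ | 0 ≤ C ∧ ∀ f, InDirichlet f →
    Real.sqrt ((1 / Real.pi) * ∫ z in D1, ‖deriv u z * f z‖ ^ 2) ≤ C * dirichletNorm f}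

/-- The logarithmic weight log(e/(1-|z|²)). -/
def logWeight (z : ℂ) : ℝ := Real.log (Real.exp 1 / (1 - ‖z‖ ^ 2))

/-- Characterization of multipliers of the Bloch space: u ∈ H^∞ and the log condition. -/
def MultBChar (u : ℂ → ℂ) : Prop :=
  (∃ M, ∀ z ∈ D1, ‖u z‖ ≤ M) ∧
  (∃ M, ∀ z ∈ D1, (1 - ‖z‖ ^ 2) * ‖deriv u z‖ * logWeight z ≤ M)

/-! ## Basic Bloch facts -/

lemma zero_mem_D1 : (0 : ℂ) ∈ D1 := by simp [D1]

lemma isOpen_D1 : IsOpen D1 := Metric.isOpen_ball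

lemma mem_D1 {z : ℂ} : z ∈ D1 ↔ ‖z‖ < 1 := by simp [D1]

instance : Nonempty D1 := ⟨⟨0, zero_mem_D1⟩⟩

lemma wt_pos {z : ℂ} (hz : z ∈ D1) : 0 < 1 - ‖z‖ ^ 2 := by
  have := mem_D1.1 hz
  nlinarith [norm_nonneg z]

lemma AnalyticOnD.diffAt {f : ℂ → ℂ} (hf : AnalyticOnD f) {z : ℂ} (hz : z ∈ D1) :
    DifferentiableAt ℂ f z := hf.differentiableAt (isOpen_D1.mem_nhds hz)

lemma semi_bound {f : ℂ → ℂ} (hf : InBloch f) {z : ℂ} (hz : z ∈ D1) :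
    (1 - ‖z‖ ^ 2) * ‖deriv f z‖ ≤ blochSemi f := by
  obtain ⟨-, C, hC⟩ := hf
  exact le_ciSup (f := fun z : D1 => (1 - ‖(z : ℂ)‖ ^ 2) * ‖deriv f (z : ℂ)‖)
    ⟨C, by rintro _ ⟨w, rfl⟩; exact hC w w.2⟩ ⟨z, hz⟩

lemma bloch_of_bound {f : ℂ → ℂ} {C : ℝ} (hf : AnalyticOnD f)
    (h : ∀ z ∈ D1, (1 - ‖z‖ ^ 2) * ‖deriv f z‖ ≤ C) :
    InBloch f ∧ blochNorm f ≤ ‖f 0‖ + C := by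
  refine ⟨⟨hf, C, h⟩, ?_⟩
  unfold blochNorm
  gcongr
  exact ciSup_le fun z => h z z.2

lemma semi_nonneg {f : ℂ → ℂ} (hf : InBloch f) : 0 ≤ blochSemi f :=
  le_trans (mul_nonneg (wt_pos zero_mem_D1).le (norm_nonneg _)) (semi_bound hf zero_mem_D1)

lemma bnorm_nonneg {f : ℂ → ℂ} (hf : InBloch f) : 0 ≤ blochNorm f :=
  add_nonneg (norm_nonneg _) (semi_nonneg hf)

lemma semi_le_norm (f : ℂ → ℂ) : blochSemi f ≤ blochNorm f := by
  unfold blochNorm; linarith [norm_nonneg (f 0)]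

lemma zero_le_norm {f : ℂ → ℂ} (hf : InBloch f) : ‖f 0‖ ≤ blochNorm f := by
  unfold blochNorm; linarith [semi_nonneg hf]

lemma deriv_congr_D {f g : ℂ → ℂ} (h : Set.EqOn f g D1) {z : ℂ} (hz : z ∈ D1) :
    deriv f z = deriv g z :=
  Filter.EventuallyEq.deriv_eq (Filter.eventuallyEq_of_mem (isOpen_D1.mem_nhds hz) h)

lemma norm_congr {f g : ℂ → ℂ} (h : Set.EqOn f g D1) : blochNorm f = blochNorm g := by
  unfold blochNorm blochSemi
  rw [h zero_mem_D1]
  congr 2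
  funext z
  rw [deriv_congr_D h z.2]

lemma inBloch_congr {f g : ℂ → ℂ} (h : Set.EqOn f g D1) (hf : InBloch f) : InBloch g := by
  obtain ⟨h1, C, hC⟩ := hf
  refine ⟨h1.congr h.symm, C, fun z hz => ?_⟩
  rw [← deriv_congr_D h hz]; exact hC z hz

lemma pt_bound {f : ℂ → ℂ} (hf : InBloch f) {z : ℂ} (hz : z ∈ D1) :
    ‖f z - f 0‖ ≤ blochSemi f / (1 - ‖z‖ ^ 2) := by
  have hz' := mem_D1.1 hz
  have hpos := wt_pos hz
  have hs := semi_nonneg hf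
  have key : ∀ w ∈ Metric.closedBall (0 : ℂ) ‖z‖, ‖deriv f w‖ ≤ blochSemi f / (1 - ‖z‖ ^ 2) := by
    intro w hw
    have hw' : ‖w‖ ≤ ‖z‖ := by simpa using hw
    have hwD : w ∈ D1 := mem_D1.2 (lt_of_le_of_lt hw' hz')
    rw [le_div_iff₀ hpos]
    refine le_trans ?_ (semi_bound hf hwD)
    rw [mul_comm]
    gcongr
  have := (convex_closedBall (0 : ℂ) ‖z‖).norm_image_sub_le_of_norm_deriv_le
    (f := f) (C := blochSemi f / (1 - ‖z‖ ^ 2)) (x := 0) (y := z)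
    (fun w hw => hf.1.diffAt (mem_D1.2 (lt_of_le_of_lt (by simpa using hw) hz'))) key
    (by simp) (by simp)
  refine this.trans ?_
  have : 0 ≤ blochSemi f / (1 - ‖z‖ ^ 2) := by positivity
  simp only [sub_zero]
  nlinarith

lemma pt_bound' {f : ℂ → ℂ} (hf : InBloch f) {z : ℂ} (hz : z ∈ D1) :
    ‖f z‖ ≤ blochNorm f / (1 - ‖z‖ ^ 2) := by
  have h1 := pt_bound hf hz
  have hpos := wt_pos hz
  have h2 : ‖f 0‖ ≤ ‖f 0‖ / (1 - ‖z‖ ^ 2) := by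
    rw [le_div_iff₀ hpos]; nlinarith [norm_nonneg (f 0), sq_nonneg ‖z‖]
  have h3 : ‖f z‖ ≤ ‖f z - f 0‖ + ‖f 0‖ := by
    simpa using norm_add_le (f z - f 0) (f 0)
  unfold blochNorm
  rw [add_div]; linarith

lemma bloch_add {f g : ℂ → ℂ} (c d : ℂ) (hf : InBloch f) (hg : InBloch g) :
    InBloch (fun z => c * f z + d * g z) ∧
      blochNorm (fun z => c * f z + d * g z) ≤ ‖c‖ * blochNorm f + ‖d‖ * blochNorm g := by
  have := bloch_of_bound (f := fun z => c * f z + d * g z)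
    (C := ‖c‖ * blochSemi f + ‖d‖ * blochSemi g)
    ((hf.1.const_mul c).add (hg.1.const_mul d)) (by
      intro z hz
      have h1 := hf.1.diffAt hz
      have h2 := hg.1.diffAt hz
      have : deriv (fun z => c * f z + d * g z) z = c * deriv f z + d * deriv g z :=
        ((h1.hasDerivAt.const_mul c).add (h2.hasDerivAt.const_mul d)).deriv
      rw [this]
      have h3 := norm_add_le (c * deriv f z) (d * deriv g z)
      rw [norm_mul, norm_mul] at h3
      have := mul_le_mul_of_nonneg_left h3 (wt_pos hz).le
      have h4 := mul_le_mul_of_nonneg_left (semi_bound hf hz) (norm_nonneg c)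
      have h5 := mul_le_mul_of_nonneg_left (semi_bound hg hz) (norm_nonneg d)
      nlinarith)
  refine ⟨this.1, this.2.trans ?_⟩
  have h3 := norm_add_le (c * f 0) (d * g 0)
  rw [norm_mul, norm_mul] at h3
  unfold blochNorm
  linarith

lemma inv_congr {T T' : (ℂ → ℂ) → (ℂ → ℂ)} (h : ∀ f, Set.EqOn (T f) (T' f) D1)
    (hlin : ∀ f g, Set.EqOn (T (fun z => 1 * f z + (-1) * g z)) (fun z => T f z - T g z) D1)
    (hT : InvertibleOnBloch T) : InvertibleOnBloch T' := by
  obtain ⟨⟨C, hC⟩, S, ⟨C', hC'⟩, hS⟩ := hT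
  refine ⟨⟨C, fun f hf => ⟨inBloch_congr (h f) (hC f hf).1, ?_⟩⟩, S, ⟨C', hC'⟩, fun f hf => ?_⟩
  · rw [← norm_congr (h f)]; exact (hC f hf).2
  · have hT'f := inBloch_congr (h f) (hC f hf).1
    have h2 : Set.EqOn (T' (S f)) f D1 := fun z hz => by rw [← h _ hz]; exact (hS f hf).2 hz
    refine ⟨?_, h2⟩
    have h3 : Set.EqOn (T (S (T' f))) (T' f) D1 := (hS _ hT'f).2
    have h4 := (hC' _ hT'f).1
    have h5 := (bloch_add 1 (-1) h4 hf).1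
    have h6 : Set.EqOn (T (fun z => 1 * S (T' f) z + (-1) * f z)) (fun _ => 0) D1 := by
      intro z hz
      rw [hlin _ _ hz]
      simp only
      rw [h3 hz, h f hz, sub_self]
    have h7 : blochNorm (fun _ => (0 : ℂ)) = 0 := by simp [blochNorm, blochSemi]
    have h8 := (hC' _ (hC _ h5).1).2
    rw [norm_congr h6, h7, mul_zero, norm_congr (hS _ h5).1] at h8
    intro z hz
    have h9 := (pt_bound' h5 hz).trans (div_nonpos_of_nonpos_of_nonneg h8 (wt_pos hz).le)
    have := norm_le_zero_iff.1 h9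
    linear_combination this

/-- Bounded analytic functions are Bloch. -/
lemma bloch_of_sup {f : ℂ → ℂ} {M : ℝ} (hf : AnalyticOnD f) (h : ∀ z ∈ D1, ‖f z‖ ≤ M) :
    InBloch f ∧ blochNorm f ≤ 3 * M := by
  have hM : 0 ≤ M := (norm_nonneg _).trans (h 0 zero_mem_D1)
  have key : ∀ z ∈ D1, (1 - ‖z‖ ^ 2) * ‖deriv f z‖ ≤ 2 * M := by
    intro z hz
    have hz' := mem_D1.1 hz
    have : ∀ r ∈ Set.Ioo 0 (1 - ‖z‖), r * ‖deriv f z‖ ≤ M := by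
      intro r hr
      have hsub : Metric.closedBall z r ⊆ D1 := by
        intro w hw
        have : ‖w - z‖ ≤ r := by simpa [dist_eq_norm] using hw
        have h2 : ‖w‖ ≤ ‖w - z‖ + ‖z‖ := by simpa using norm_add_le (w - z) z
        exact mem_D1.2 (by linarith [hr.2])
      have hd : DiffContOnCl ℂ f (Metric.ball z r) :=
        DifferentiableOn.diffContOnCl_ball hf hsub
      have := Complex.norm_deriv_le_of_forall_mem_sphere_norm_le hr.1 hd
        (fun w hw => h w (hsub (Metric.sphere_subset_closedBall hw)))
      rw [le_div_iff₀ hr.1] at this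
      linarith
    have h1 : (1 - ‖z‖) * ‖deriv f z‖ ≤ M := by
      have ht : Tendsto (fun r : ℝ => r * ‖deriv f z‖) (nhdsWithin (1 - ‖z‖) (Set.Iio (1 - ‖z‖)))
          (nhds ((1 - ‖z‖) * ‖deriv f z‖)) := by
        apply Tendsto.mono_left _ nhdsWithin_le_nhds
        exact (continuous_id.mul continuous_const).tendsto _
      refine le_of_tendsto ht ?_
      filter_upwards [Ioo_mem_nhdsLT (show (0:ℝ) < 1 - ‖z‖ by linarith)] with r hr
      exact this r hr
    have h2 := mul_nonneg (sub_nonneg.2 hz'.le) (norm_nonneg (deriv f z))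
    nlinarith [norm_nonneg z]
  obtain ⟨h1, h2⟩ := bloch_of_bound hf key
  exact ⟨h1, by linarith [h 0 zero_mem_D1]⟩

/-- Self-maps of the disc satisfying the Schwarz-Pick inequality. -/
structure GoodMap (φ : ℂ → ℂ) : Prop where
  maps : ∀ z ∈ D1, φ z ∈ D1
  diff : AnalyticOnD φ
  sp : ∀ z ∈ D1, (1 - ‖z‖ ^ 2) * ‖deriv φ z‖ ≤ 1 - ‖φ z‖ ^ 2

lemma comp_diff {f φ : ℂ → ℂ} (hφ : GoodMap φ) (hf : AnalyticOnD f) :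
    AnalyticOnD (fun z => f (φ z)) := hf.comp hφ.diff hφ.maps

lemma comp_deriv {f φ : ℂ → ℂ} (hφ : GoodMap φ) (hf : AnalyticOnD f) {z : ℂ} (hz : z ∈ D1) :
    HasDerivAt (fun z => f (φ z)) (deriv f (φ z) * deriv φ z) z :=
  HasDerivAt.comp z (hf.diffAt (hφ.maps z hz)).hasDerivAt (hφ.diff.diffAt hz).hasDerivAt

lemma comp_semi {φ : ℂ → ℂ} (f : ℂ → ℂ) (hφ : GoodMap φ) {z : ℂ} (hz : z ∈ D1) :
    (1 - ‖z‖ ^ 2) * (‖deriv f (φ z)‖ * ‖deriv φ z‖) ≤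
      (1 - ‖φ z‖ ^ 2) * ‖deriv f (φ z)‖ := by
  have := mul_le_mul_of_nonneg_right (hφ.sp z hz) (norm_nonneg (deriv f (φ z)))
  linarith

lemma comp_bloch {f φ : ℂ → ℂ} (hφ : GoodMap φ) (hf : InBloch f) :
    InBloch (fun z => f (φ z)) ∧ blochSemi (fun z => f (φ z)) ≤ blochSemi f := by
  have key : ∀ z ∈ D1, (1 - ‖z‖ ^ 2) * ‖deriv (fun z => f (φ z)) z‖ ≤ blochSemi f := by
    intro z hz
    rw [(comp_deriv hφ hf.1 hz).deriv, norm_mul]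
    exact (comp_semi f hφ hz).trans (semi_bound hf (hφ.maps z hz))
  exact ⟨(bloch_of_bound (comp_diff hφ hf.1) key).1, ciSup_le fun z => key z z.2⟩

lemma iter_maps {φ : ℂ → ℂ} (hφ : GoodMap φ) (n : ℕ) : ∀ z ∈ D1, φ^[n] z ∈ D1 := by
  induction n with
  | zero => intro z hz; simpa
  | succ n ih => intro z hz; rw [Function.iterate_succ_apply]; exact ih _ (hφ.maps z hz)

lemma comp_iter {φ : ℂ → ℂ} (hφ : GoodMap φ) {f : ℂ → ℂ} (hf : InBloch f) (n : ℕ) :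
    InBloch (fun z => f (φ^[n] z)) ∧
    blochNorm (fun z => f (φ^[n] z)) ≤ (1 + n / (1 - ‖φ 0‖ ^ 2)) * blochNorm f := by
  suffices h : InBloch (fun z => f (φ^[n] z)) ∧ blochSemi (fun z => f (φ^[n] z)) ≤ blochSemi f ∧
      ‖f (φ^[n] 0)‖ ≤ ‖f 0‖ + n / (1 - ‖φ 0‖ ^ 2) * blochSemi f by
    refine ⟨h.1, ?_⟩
    have hw := wt_pos (hφ.maps 0 zero_mem_D1)
    have h1 : 0 ≤ (n : ℝ) / (1 - ‖φ 0‖ ^ 2) := by positivity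
    have h2 := mul_nonneg h1 (norm_nonneg (f 0))
    unfold blochNorm
    nlinarith [h.2.1, h.2.2]
  induction n with
  | zero => simpa using hf
  | succ n ih =>
    obtain ⟨h1, h2, h3⟩ := ih
    have h4 := comp_bloch hφ h1
    simp only [Function.iterate_succ_apply]
    refine ⟨h4.1, h4.2.trans h2, ?_⟩
    have h5 := pt_bound h1 (hφ.maps 0 zero_mem_D1)
    have hw := wt_pos (hφ.maps 0 zero_mem_D1)
    have h6 : ‖f (φ^[n] (φ 0))‖ ≤ ‖f (φ^[n] (φ 0)) - f (φ^[n] 0)‖ + ‖f (φ^[n] 0)‖ := by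
      simpa using norm_add_le (f (φ^[n] (φ 0)) - f (φ^[n] 0)) (f (φ^[n] 0))
    have h7 : blochSemi (fun z => f (φ^[n] z)) / (1 - ‖φ 0‖ ^ 2) ≤
      blochSemi f / (1 - ‖φ 0‖ ^ 2) := by gcongr
    have h8 : ((n + 1 : ℕ) : ℝ) / (1 - ‖φ 0‖ ^ 2) * blochSemi f =
      n / (1 - ‖φ 0‖ ^ 2) * blochSemi f + blochSemi f / (1 - ‖φ 0‖ ^ 2) := by
      push_cast; ring
    linarith
/-! ## Power bounds and Neumann series -/

lemma wprod_succ' (u φ : ℂ → ℂ) (n : ℕ) (z : ℂ) :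
    wprod u φ (n + 1) z = u z * wprod u φ n (φ z) := by
  simp only [wprod, Finset.prod_range_succ', Function.iterate_succ_apply,
    Function.iterate_zero, id]
  ring

def Fpow (u φ f : ℂ → ℂ) (n : ℕ) : ℂ → ℂ := fun z => wprod u φ n z * f (φ^[n] z)

lemma Fpow_zero (u φ f : ℂ → ℂ) (z : ℂ) : Fpow u φ f 0 z = f z := by simp [Fpow, wprod]

lemma Fpow_succ (u φ f : ℂ → ℂ) (n : ℕ) (z : ℂ) :
    Fpow u φ f (n + 1) z = u z * Fpow u φ f n (φ z) := by
  simp only [Fpow, wprod_succ', Function.iterate_succ_apply]; ring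

lemma wprod_comm (u φ : ℂ → ℂ) (n : ℕ) (z : ℂ) :
    wprod u φ (n + 1) z = wprod u φ n z * u (φ^[n] z) := by
  simp only [wprod, Finset.prod_range_succ]

lemma Fpow_wco (u φ f : ℂ → ℂ) (n : ℕ) (z : ℂ) :
    Fpow u φ (wco u φ f) n z = Fpow u φ f (n + 1) z := by
  simp only [Fpow, wco, wprod_comm, Function.iterate_succ_apply']; ring

lemma mult_bound {u φ : ℂ → ℂ} {M : ℝ} (hφ : GoodMap φ) (hu : AnalyticOnD u)
    (hM : ∀ z ∈ D1, ‖u z‖ ≤ M) (hb : BddOnBloch (wco u φ)) :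
    ∃ M1 : ℝ, 0 ≤ M1 ∧ ∀ g, InBloch g → ∀ z ∈ D1,
      (1 - ‖z‖ ^ 2) * (‖deriv u z‖ * ‖g (φ z)‖) ≤ M1 * blochNorm g := by
  obtain ⟨C, hC⟩ := hb
  have hM0 : 0 ≤ M := (norm_nonneg _).trans (hM 0 zero_mem_D1)
  refine ⟨|C| + M, by positivity, fun g hg z hz => ?_⟩
  obtain ⟨h1, h2⟩ := hC g hg
  have h3 := semi_bound h1 hz
  have hd : HasDerivAt (wco u φ g)
      (deriv u z * g (φ z) + u z * (deriv g (φ z) * deriv φ z)) z :=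
    (hu.diffAt hz).hasDerivAt.mul (comp_deriv hφ hg.1 hz)
  rw [hd.deriv] at h3
  have h4 := comp_semi g hφ hz
  have h5 := h4.trans (semi_bound hg (hφ.maps z hz))
  have h6 : ‖deriv u z‖ * ‖g (φ z)‖ ≤
      ‖deriv u z * g (φ z) + u z * (deriv g (φ z) * deriv φ z)‖ +
        ‖u z‖ * (‖deriv g (φ z)‖ * ‖deriv φ z‖) := by
    have := norm_sub_le (deriv u z * g (φ z) + u z * (deriv g (φ z) * deriv φ z))
      (u z * (deriv g (φ z) * deriv φ z))
    simpa using this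
  have h7 := mul_le_mul_of_nonneg_left h6 (wt_pos hz).le
  have h8 : ‖u z‖ * ((1 - ‖z‖ ^ 2) * (‖deriv g (φ z)‖ * ‖deriv φ z‖)) ≤ M * blochNorm g :=
    mul_le_mul (hM z hz) (h5.trans (semi_le_norm g))
      (mul_nonneg (wt_pos hz).le (by positivity)) hM0
  have h9 : blochSemi (wco u φ g) ≤ |C| * blochNorm g :=
    ((semi_le_norm _).trans h2).trans
      (mul_le_mul_of_nonneg_right (le_abs_self C) (bnorm_nonneg hg))
  nlinarith

lemma pow_bound {u φ : ℂ → ℂ} {M δ K r : ℝ} (hφ : GoodMap φ) (hu : AnalyticOnD u)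
    (hM : ∀ z ∈ D1, ‖u z‖ ≤ M) (hδ : 0 < δ) (hd : ∀ z ∈ D1, δ ≤ ‖u z‖)
    (hb : BddOnBloch (wco u φ)) (hr : 0 ≤ r)
    (hK : ∀ n, ∀ z ∈ D1, ‖wprod u φ n z‖ ≤ K * r ^ n) :
    ∃ E : ℝ, 0 ≤ E ∧ ∀ f, InBloch f → ∀ n : ℕ, InBloch (Fpow u φ f n) ∧
      blochNorm (Fpow u φ f n) ≤ E * ((n + 1 : ℝ) ^ 2 * r ^ n) * blochNorm f := by
  obtain ⟨M1, hM1, hm⟩ := mult_bound hφ hu hM hb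
  set Q : ℝ := 1 / (1 - ‖φ 0‖ ^ 2) with hQ
  have hw := wt_pos (hφ.maps 0 zero_mem_D1)
  have hQ0 : 0 ≤ Q := by positivity
  have hK0 : 0 ≤ K := by
    have := (norm_nonneg _).trans (hK 0 0 zero_mem_D1); simpa using this
  set E0 : ℝ := 1 + δ⁻¹ * M1 * (1 + Q) with hE0
  have hE00 : 0 ≤ E0 := by positivity
  refine ⟨K * (E0 + 1 + Q), by positivity, fun f hf => ?_⟩
  have hfn := bnorm_nonneg hf
  have hit : ∀ n : ℕ, blochNorm (fun z => f (φ^[n] z)) ≤ (1 + n * Q) * blochNorm f := by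
    intro n
    have := (comp_iter hφ hf n).2
    rwa [div_eq_mul_one_div] at this
  have key : ∀ n : ℕ, AnalyticOnD (Fpow u φ f n) ∧ ∀ z ∈ D1,
      (1 - ‖z‖ ^ 2) * ‖deriv (Fpow u φ f n) z‖ ≤
        ‖wprod u φ n z‖ * (E0 * (n + 1 : ℝ) ^ 2 * blochNorm f) := by
    intro n
    induction n with
    | zero =>
      have : Fpow u φ f 0 = f := funext (Fpow_zero u φ f)
      rw [this]
      refine ⟨hf.1, fun z hz => ?_⟩
      have h1 := (semi_bound hf hz).trans (semi_le_norm f)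
      have h2 : wprod u φ 0 z = 1 := by simp [wprod]
      have h3 : 0 ≤ δ⁻¹ * M1 * (1 + Q) := by positivity
      rw [h2]
      simp only [norm_one, CharP.cast_eq_zero]
      have := mul_nonneg h3 hfn
      nlinarith
    | succ n ih =>
      obtain ⟨ih1, ih2⟩ := ih
      have he : Fpow u φ f (n + 1) = fun z => u z * Fpow u φ f n (φ z) :=
        funext (Fpow_succ u φ f n)
      rw [he]
      refine ⟨hu.mul (comp_diff hφ ih1), fun z hz => ?_⟩
      have hd1 : HasDerivAt (fun z => u z * Fpow u φ f n (φ z))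
          (deriv u z * Fpow u φ f n (φ z) + u z * (deriv (Fpow u φ f n) (φ z) * deriv φ z)) z :=
        (hu.diffAt hz).hasDerivAt.mul (comp_deriv hφ ih1 hz)
      rw [hd1.deriv]
      have hwp : ‖wprod u φ (n + 1) z‖ = ‖u z‖ * ‖wprod u φ n (φ z)‖ := by
        rw [wprod_succ', norm_mul]
      set p := ‖wprod u φ n (φ z)‖ with hp
      have hp0 : 0 ≤ p := norm_nonneg _
      have hp1 : p ≤ δ⁻¹ * ‖wprod u φ (n + 1) z‖ := by
        rw [hwp, inv_mul_eq_div, le_div_iff₀ hδ, mul_comm]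
        exact mul_le_mul_of_nonneg_right (hd z hz) hp0
      -- first term
      have t1 : (1 - ‖z‖ ^ 2) * ‖deriv u z * Fpow u φ f n (φ z)‖ ≤
          δ⁻¹ * ‖wprod u φ (n + 1) z‖ * (M1 * ((1 + n * Q) * blochNorm f)) := by
        have h1 := hm _ (comp_iter hφ hf n).1 z hz
        have h2 : (1 - ‖z‖ ^ 2) * (‖deriv u z‖ * ‖f (φ^[n] (φ z))‖) ≤
            M1 * ((1 + n * Q) * blochNorm f) :=
          h1.trans (mul_le_mul_of_nonneg_left (hit n) hM1)
        have h3 : 0 ≤ (1 - ‖z‖ ^ 2) * (‖deriv u z‖ * ‖f (φ^[n] (φ z))‖) :=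
          mul_nonneg (wt_pos hz).le (by positivity)
        calc (1 - ‖z‖ ^ 2) * ‖deriv u z * Fpow u φ f n (φ z)‖
            = p * ((1 - ‖z‖ ^ 2) * (‖deriv u z‖ * ‖f (φ^[n] (φ z))‖)) := by
              simp only [Fpow, norm_mul, hp]; ring
          _ ≤ _ := mul_le_mul hp1 h2 h3 (hp0.trans hp1)
      have t2 : (1 - ‖z‖ ^ 2) * ‖u z * (deriv (Fpow u φ f n) (φ z) * deriv φ z)‖ ≤
          ‖wprod u φ (n + 1) z‖ * (E0 * (n + 1 : ℝ) ^ 2 * blochNorm f) := by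
        have h1 := (comp_semi (Fpow u φ f n) hφ hz).trans (ih2 _ (hφ.maps z hz))
        have h2 := mul_le_mul_of_nonneg_left h1 (norm_nonneg (u z))
        rw [norm_mul, norm_mul, hwp]
        linarith
      have t3 := mul_le_mul_of_nonneg_left (norm_add_le (deriv u z * Fpow u φ f n (φ z))
        (u z * (deriv (Fpow u φ f n) (φ z) * deriv φ z))) (wt_pos hz).le
      have t4 : δ⁻¹ * (M1 * (1 + n * Q)) ≤ E0 * (2 * n + 3) := by
        have hn : (0 : ℝ) ≤ n := Nat.cast_nonneg n
        have a1 : 0 ≤ δ⁻¹ * M1 := by positivity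
        have a2 : (1 + n * Q) ≤ (1 + Q) * (2 * n + 3) := by nlinarith [mul_nonneg hn hQ0]
        have a3 := mul_le_mul_of_nonneg_left a2 a1
        rw [hE0]; nlinarith
      have t5 := mul_le_mul_of_nonneg_left t4
        (mul_nonneg (norm_nonneg (wprod u φ (n + 1) z)) hfn)
      push_cast
      nlinarith
  intro n
  obtain ⟨k1, k2⟩ := key n
  have hn : (0 : ℝ) ≤ n := Nat.cast_nonneg n
  have hpos : 0 ≤ E0 * (n + 1 : ℝ) ^ 2 * blochNorm f := by positivity
  obtain ⟨b1, b2⟩ := bloch_of_bound k1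
    (fun z hz => (k2 z hz).trans (mul_le_mul_of_nonneg_right (hK n z hz) hpos))
  refine ⟨b1, b2.trans ?_⟩
  have c1 : ‖f (φ^[n] 0)‖ ≤ (1 + n * Q) * blochNorm f :=
    (zero_le_norm (comp_iter hφ hf n).1).trans (hit n)
  have c2 : ‖Fpow u φ f n 0‖ ≤ K * r ^ n * ((1 + n * Q) * blochNorm f) := by
    simp only [Fpow, norm_mul]
    exact mul_le_mul (hK n 0 zero_mem_D1) c1 (norm_nonneg _) (by positivity)
  have c3 : 1 + n * Q ≤ (1 + Q) * (n + 1) ^ 2 := by nlinarith [mul_nonneg hn hQ0, mul_nonneg (mul_nonneg hn hn) hQ0]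
  have c4 := mul_le_mul_of_nonneg_left c3 (show 0 ≤ K * r ^ n * blochNorm f by positivity)
  nlinarith

lemma neumann {u φ : ℂ → ℂ} {M δ K r : ℝ} {lam : ℂ} (hφ : GoodMap φ) (hu : AnalyticOnD u)
    (hM : ∀ z ∈ D1, ‖u z‖ ≤ M) (hδ : 0 < δ) (hd : ∀ z ∈ D1, δ ≤ ‖u z‖)
    (hb : BddOnBloch (wco u φ)) (hr : 0 ≤ r)
    (hK : ∀ n, ∀ z ∈ D1, ‖wprod u φ n z‖ ≤ K * r ^ n) (hlam : r < ‖lam‖) :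
    InvertibleOnBloch (fun f z => lam * f z - wco u φ f z) := by
  obtain ⟨E, hE, hpow⟩ := pow_bound hφ hu hM hδ hd hb hr hK
  have hl0 : 0 < ‖lam‖ := lt_of_le_of_lt hr hlam
  have hl : lam ≠ 0 := norm_pos_iff.1 hl0
  set c : ℕ → ℝ := fun n => ‖lam‖⁻¹ ^ (n + 1) * (E * ((n + 1 : ℝ) ^ 2 * r ^ n)) with hc
  have hc0 : ∀ n, 0 ≤ c n := fun n => by positivity
  have hsum : Summable c := by
    have hx : ‖r / ‖lam‖‖ < 1 := by
      rw [Real.norm_eq_abs, abs_of_nonneg (by positivity), div_lt_one hl0]; exact hlam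
    have h2 := summable_pow_mul_geometric_of_norm_lt_one 2 hx
    have h1 := summable_pow_mul_geometric_of_norm_lt_one 1 hx
    have h0 := summable_geometric_of_norm_lt_one hx
    have := (((h2.add (h1.mul_left 2)).add h0).mul_left (‖lam‖⁻¹ * E))
    refine this.congr fun n => ?_
    simp only [hc, div_pow, pow_succ, inv_pow]
    field_simp
    ring
  set B := ∑' n, c n with hB
  let G : (ℂ → ℂ) → ℕ → ℂ → ℂ := fun f n z => lam⁻¹ ^ (n + 1) * Fpow u φ f n z
  have hG : ∀ f, InBloch f → ∀ n, InBloch (G f n) ∧ blochNorm (G f n) ≤ c n * blochNorm f := by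
    intro f hf n
    obtain ⟨h1, h2⟩ := hpow f hf n
    have h3 := bloch_add (lam⁻¹ ^ (n + 1)) 0 h1 h1
    simp only [zero_mul, add_zero, norm_zero] at h3
    refine ⟨h3.1, h3.2.trans ?_⟩
    rw [norm_pow, norm_inv, hc]
    have := mul_le_mul_of_nonneg_left h2 (show 0 ≤ ‖lam‖⁻¹ ^ (n + 1) by positivity)
    linarith
  have hGs : ∀ f, InBloch f → ∀ z ∈ D1, Summable (fun n => G f n z) := by
    intro f hf z hz
    refine Summable.of_norm_bounded
      (g := fun n => c n * (blochNorm f / (1 - ‖z‖ ^ 2))) (hsum.mul_right _) fun n => ?_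
    refine (pt_bound' (hG f hf n).1 hz).trans ?_
    rw [← mul_div_assoc]
    exact div_le_div_of_nonneg_right (hG f hf n).2 (wt_pos hz).le
  let S : (ℂ → ℂ) → (ℂ → ℂ) := fun f z => ∑' n, G f n z
  have hS : BddOnBloch S := by
    refine ⟨B + B, fun f hf => ?_⟩
    have hfn := bnorm_nonneg hf
    have hloc : ∀ z ∈ D1, DifferentiableAt ℂ (S f) z ∧
        HasSum (fun n => deriv (G f n) z) (deriv (S f) z) := by
      intro z hz
      obtain ⟨ρ, h1, h2⟩ := exists_between (mem_D1.1 hz)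
      have hρ : 0 < ρ := (norm_nonneg z).trans_lt h1
      have hsub : Metric.ball (0 : ℂ) ρ ⊆ D1 := Metric.ball_subset_ball h2.le
      have hzb : z ∈ Metric.ball (0 : ℂ) ρ := by simpa using h1
      have hbd : ∀ n w, w ∈ Metric.ball (0 : ℂ) ρ →
          ‖G f n w‖ ≤ c n * (blochNorm f / (1 - ρ ^ 2)) := by
        intro n w hw
        have hw' : ‖w‖ < ρ := by simpa using hw
        have hρ2 : 0 < 1 - ρ ^ 2 := by nlinarith
        refine (pt_bound' (hG f hf n).1 (hsub hw)).trans ?_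
        rw [← mul_div_assoc]
        have := hc0 n
        refine div_le_div₀ (by positivity) (hG f hf n).2 hρ2 ?_
        gcongr
      have hdiff : ∀ n, DifferentiableOn ℂ (G f n) (Metric.ball (0 : ℂ) ρ) :=
        fun n => (hG f hf n).1.1.mono hsub
      have hs := hsum.mul_right (blochNorm f / (1 - ρ ^ 2))
      refine ⟨(Complex.differentiableOn_tsum_of_summable_norm hs hdiff Metric.isOpen_ball hbd
        ).differentiableAt (Metric.isOpen_ball.mem_nhds hzb), ?_⟩
      exact Complex.hasSum_deriv_of_summable_norm hs hdiff Metric.isOpen_ball hbd hzb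
    have han : AnalyticOnD (S f) := fun z hz => (hloc z hz).1.differentiableWithinAt
    have hder : ∀ z ∈ D1, (1 - ‖z‖ ^ 2) * ‖deriv (S f) z‖ ≤ B * blochNorm f := by
      intro z hz
      have h1 := (hloc z hz).2
      have h2 : ∀ n, ‖deriv (G f n) z‖ ≤ c n * (blochNorm f / (1 - ‖z‖ ^ 2)) := by
        intro n
        rw [← mul_div_assoc, le_div_iff₀ (wt_pos hz), mul_comm]
        exact (semi_bound (hG f hf n).1 hz).trans ((semi_le_norm _).trans (hG f hf n).2)
      have h3 := tsum_of_norm_bounded (hsum.hasSum.mul_right _) h2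
      rw [h1.tsum_eq, ← mul_div_assoc, le_div_iff₀ (wt_pos hz), mul_comm] at h3
      exact h3
    obtain ⟨b1, b2⟩ := bloch_of_bound han hder
    refine ⟨b1, b2.trans ?_⟩
    have h4 : ‖S f 0‖ ≤ B * blochNorm f :=
      tsum_of_norm_bounded (hsum.hasSum.mul_right _)
        fun n => (zero_le_norm (hG f hf n).1).trans (hG f hf n).2
    linarith
  have hTb : BddOnBloch (fun f z => lam * f z - wco u φ f z) := by
    obtain ⟨C, hC⟩ := hb
    refine ⟨‖lam‖ + C, fun f hf => ?_⟩
    have h1 := bloch_add lam (-1) hf (hC f hf).1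
    have he : (fun z => lam * f z + -1 * wco u φ f z) = fun z => lam * f z - wco u φ f z := by
      funext z; ring
    rw [he] at h1
    refine ⟨h1.1, h1.2.trans ?_⟩
    have := (hC f hf).2
    simp only [norm_neg, norm_one]
    linarith
  have htel : ∀ f, InBloch f → ∀ z ∈ D1,
      HasSum (fun n => lam * G f n z - lam * G f (n + 1) z) (f z) := by
    intro f hf z hz
    have hs := (hGs f hf z hz).mul_left lam
    have h1 := hs.hasSum
    have h2 := (hasSum_nat_add_iff' 1).2 h1
    have h3 := h1.sub h2
    have h4 : lam * G f 0 z = f z := by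
      change lam * (lam⁻¹ ^ (0 + 1) * Fpow u φ f 0 z) = f z
      rw [Fpow_zero, zero_add, pow_one, mul_inv_cancel_left₀ hl]
    rw [Finset.sum_range_one, h4, sub_sub_cancel] at h3
    exact h3
  refine ⟨hTb, S, hS, fun f hf => ⟨fun z hz => ?_, fun z hz => ?_⟩⟩
  · have h1 := (htel f hf z hz).tsum_eq
    rw [← h1]
    refine tsum_congr fun n => ?_
    change lam⁻¹ ^ (n + 1) * Fpow u φ (fun z => lam * f z - wco u φ f z) n z =
      lam * (lam⁻¹ ^ (n + 1) * Fpow u φ f n z) -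
        lam * (lam⁻¹ ^ (n + 1 + 1) * Fpow u φ f (n + 1) z)
    have : Fpow u φ (fun z => lam * f z - wco u φ f z) n z =
        lam * Fpow u φ f n z - Fpow u φ f (n + 1) z := by
      rw [← Fpow_wco]; simp only [Fpow]; ring
    rw [this, pow_succ (lam⁻¹) (n + 1)]
    field_simp
  · have h1 := (htel f hf z hz).tsum_eq
    change lam * S f z - u z * S f (φ z) = f z
    have h2 := (hGs f hf z hz).hasSum.mul_left lam
    have h3 := (hGs f hf _ (hφ.maps z hz)).hasSum.mul_left (u z)
    have h4 := (h2.sub h3).tsum_eq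
    rw [← h1]
    refine h4.symm.trans (tsum_congr fun n => ?_)
    simp only [G]
    rw [Fpow_succ, pow_succ (lam⁻¹) (n + 1)]
    field_simp

/-- A weight of an invertible weighted composition operator is bounded below. -/
lemma lower_bound {u φ : ℂ → ℂ} (hφ : GoodMap φ) (hinv : InvertibleOnBloch (wco u φ)) :
    ∃ δ > 0, ∀ z ∈ D1, δ ≤ ‖u z‖ := by
  obtain ⟨-, S, ⟨C, hC⟩, hS⟩ := hinv
  let R : (ℂ → ℂ) → (ℂ → ℂ) := fun f z => S f (φ z)
  set Q : ℝ := 1 + (1 : ℕ) / (1 - ‖φ 0‖ ^ 2) with hQ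
  have hQ0 : 0 ≤ Q := by have := wt_pos (hφ.maps 0 zero_mem_D1); positivity
  set K := Q * |C| + 1 with hK
  have hK1 : 0 < K := by positivity
  have hR : ∀ f, InBloch f → InBloch (R f) ∧ blochNorm (R f) ≤ K * blochNorm f := by
    intro f hf
    obtain ⟨h1, h2⟩ := hC f hf
    have h3 := comp_iter hφ h1 1
    refine ⟨h3.1, h3.2.trans ?_⟩
    have hfn := bnorm_nonneg hf
    have h4 : blochNorm (S f) ≤ |C| * blochNorm f :=
      h2.trans (mul_le_mul_of_nonneg_right (le_abs_self C) hfn)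
    have := mul_le_mul_of_nonneg_left h4 hQ0
    rw [← hQ, hK]; linarith
  have hone : InBloch (fun _ => (1 : ℂ)) ∧ blochNorm (fun _ => (1 : ℂ)) ≤ 3 * 1 :=
    bloch_of_sup (differentiableOn_const _) (by simp)
  have hpow : ∀ n, InBloch (R^[n] fun _ => 1) ∧ blochNorm (R^[n] fun _ => 1) ≤ K ^ n * 3 ∧
      ∀ z ∈ D1, u z ^ n * (R^[n] fun _ => 1) z = 1 := by
    intro n
    induction n with
    | zero => refine ⟨hone.1, ?_, ?_⟩ <;> simp; linarith [hone.2]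
    | succ n ih =>
      obtain ⟨i1, i2, i3⟩ := ih
      rw [Function.iterate_succ_apply']
      obtain ⟨r1, r2⟩ := hR _ i1
      refine ⟨r1, r2.trans ?_, fun z hz => ?_⟩
      · have := mul_le_mul_of_nonneg_left i2 hK1.le
        rw [pow_succ]; linarith
      · have h1 : u z * R (R^[n] fun _ => 1) z = (R^[n] fun _ => 1) z := (hS _ i1).2 hz
        calc _ = u z ^ n * (u z * R (R^[n] fun _ => 1) z) := by ring
          _ = 1 := by rw [h1]; exact i3 z hz
  refine ⟨K⁻¹, by positivity, fun z hz => ?_⟩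
  by_contra hlt
  push Not at hlt
  have hx : ‖u z‖ * K < 1 := by
    rwa [← one_div, lt_div_iff₀ hK1] at hlt
  have hw := wt_pos hz
  have hle : ∀ n : ℕ, 1 - ‖z‖ ^ 2 ≤ (‖u z‖ * K) ^ n * 3 := by
    intro n
    obtain ⟨i1, i2, i3⟩ := hpow n
    have h1 := congrArg norm (i3 z hz)
    rw [norm_mul, norm_pow, norm_one] at h1
    have h2 := (pt_bound' i1 hz).trans (div_le_div_of_nonneg_right i2 hw.le)
    have h3 := mul_le_mul_of_nonneg_left h2 (show 0 ≤ ‖u z‖ ^ n by positivity)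
    rw [h1, ← mul_div_assoc, le_div_iff₀ hw] at h3
    rw [mul_pow]; linarith
  have ht := (tendsto_pow_atTop_nhds_zero_of_lt_one (by positivity) hx).mul_const 3
  have := ge_of_tendsto' ht hle
  linarith
/-! ## Cayley geometry -/

def Hc (a z : ℂ) : ℂ := (a + z) / (a - z)

def Ci (a h : ℂ) : ℂ := a * (h - 1) / (h + 1)

def Phi (a : ℂ) (t : ℝ) (z : ℂ) : ℂ := Ci a (Hc a z + I * t)

lemma a_ne {a : ℂ} (ha : ‖a‖ = 1) : a ≠ 0 := by
  rintro rfl; simp at ha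

lemma sub_ne {a z : ℂ} (ha : ‖a‖ = 1) (hz : z ∈ D1) : a - z ≠ 0 := by
  intro h
  have := mem_D1.1 hz
  rw [← sub_eq_zero.1 h, ha] at this
  exact lt_irrefl _ this

lemma re_H {a z : ℂ} (ha : ‖a‖ = 1) (hz : z ∈ D1) :
    (Hc a z).re * ‖a - z‖ ^ 2 = 1 - ‖z‖ ^ 2 := by
  have h0 : Complex.normSq (a - z) ≠ 0 := by simpa using sub_ne ha hz
  have h1 : Complex.normSq a = 1 := by rw [Complex.normSq_eq_norm_sq, ha]; norm_num
  rw [← Complex.normSq_eq_norm_sq, ← Complex.normSq_eq_norm_sq, ← h1]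
  unfold Hc
  rw [Complex.div_re]
  field_simp
  simp only [Complex.normSq_apply, Complex.add_re, Complex.sub_re, Complex.add_im, Complex.sub_im]
  ring

lemma re_H_pos {a z : ℂ} (ha : ‖a‖ = 1) (hz : z ∈ D1) : 0 < (Hc a z).re := by
  have h1 := re_H ha hz
  have h2 := wt_pos hz
  rw [← h1] at h2
  exact pos_of_mul_pos_left h2 (by positivity)

lemma h1_ne {h : ℂ} (hh : 0 < h.re) : h + 1 ≠ 0 := by
  intro h0
  have := congrArg Complex.re h0
  simp at this
  linarith

lemma Ci_mem {a h : ℂ} (ha : ‖a‖ = 1) (hh : 0 < h.re) : Ci a h ∈ D1 := by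
  rw [mem_D1, Ci, norm_div, norm_mul, ha, one_mul, div_lt_one (norm_pos_iff.2 (h1_ne hh))]
  apply lt_of_pow_lt_pow_left₀ 2 (norm_nonneg _)
  rw [← Complex.normSq_eq_norm_sq, ← Complex.normSq_eq_norm_sq]
  simp [Complex.normSq_apply]
  nlinarith

lemma H_Ci {a h : ℂ} (ha : ‖a‖ = 1) (hh : 0 < h.re) : Hc a (Ci a h) = h := by
  have h1 := sub_ne ha (Ci_mem ha hh)
  have h2 := h1_ne hh
  have h3 := a_ne ha
  unfold Hc
  rw [div_eq_iff h1]
  unfold Ci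
  field_simp
  ring

lemma Ci_H {a z : ℂ} (ha : ‖a‖ = 1) (hz : z ∈ D1) : Ci a (Hc a z) = z := by
  have h1 := sub_ne ha hz
  have h2 := h1_ne (re_H_pos ha hz)
  have h3 := a_ne ha
  unfold Ci
  rw [div_eq_iff h2]
  unfold Hc
  field_simp
  ring

lemma Phi_re {a z : ℂ} (ha : ‖a‖ = 1) (t : ℝ) (hz : z ∈ D1) : 0 < (Hc a z + I * t).re := by
  have := re_H_pos ha hz
  simpa using this

lemma H_Phi {a z : ℂ} (ha : ‖a‖ = 1) (t : ℝ) (hz : z ∈ D1) :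
    Hc a (Phi a t z) = Hc a z + I * t := H_Ci ha (Phi_re ha t hz)

lemma Phi_Phi {a z : ℂ} (ha : ‖a‖ = 1) (t s : ℝ) (hst : t + s = 0) (hz : z ∈ D1) :
    Phi a s (Phi a t z) = z := by
  have h : (t : ℂ) + s = 0 := by exact_mod_cast hst
  rw [Phi, H_Phi ha t hz]
  have : Hc a z + I * t + I * s = Hc a z := by linear_combination I * h
  rw [this, Ci_H ha hz]

lemma hasDeriv_H {a z : ℂ} (ha : ‖a‖ = 1) (hz : z ∈ D1) :
    HasDerivAt (Hc a) (2 * a / (a - z) ^ 2) z := by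
  have h1 : HasDerivAt (Hc a) ((1 * (a - z) - (a + z) * (-1)) / (a - z) ^ 2) z :=
    ((hasDerivAt_id z).const_add a).div ((hasDerivAt_id z).const_sub a) (sub_ne ha hz)
  convert h1 using 2
  ring

lemma wt_H {a z : ℂ} (ha : ‖a‖ = 1) (hz : z ∈ D1) :
    (1 - ‖z‖ ^ 2) * ‖2 * a / (a - z) ^ 2‖ = 2 * (Hc a z).re := by
  have h : ‖a - z‖ ≠ 0 := norm_ne_zero_iff.2 (sub_ne ha hz)
  rw [← re_H ha hz, norm_div, norm_mul, norm_pow, ha]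
  simp only [Complex.norm_ofNat, mul_one]
  field_simp

lemma Phi_good {a : ℂ} (ha : ‖a‖ = 1) (t : ℝ) : GoodMap (Phi a t) := by
  have hm : ∀ z ∈ D1, Phi a t z ∈ D1 := fun z hz => Ci_mem ha (Phi_re ha t hz)
  have hdiff : AnalyticOnD (Phi a t) := by
    intro z hz
    have h1 : DifferentiableAt ℂ (fun z => Hc a z + I * t) z :=
      (hasDeriv_H ha hz).differentiableAt.add_const _
    have h2 := ((h1.sub_const 1).const_mul a).div (h1.add_const 1) (h1_ne (Phi_re ha t hz))
    exact h2.differentiableWithinAt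
  refine ⟨hm, hdiff, fun z hz => le_of_eq ?_⟩
  have hw := hm z hz
  have hd1 : HasDerivAt (fun z => Hc a (Phi a t z))
      (2 * a / (a - Phi a t z) ^ 2 * deriv (Phi a t) z) z :=
    HasDerivAt.comp z (hasDeriv_H ha hw) (hdiff.diffAt hz).hasDerivAt
  have hd2 : HasDerivAt (fun z => Hc a z + I * t) (2 * a / (a - z) ^ 2) z :=
    (hasDeriv_H ha hz).add_const _
  have he : (fun z => Hc a (Phi a t z)) =ᶠ[nhds z] fun z => Hc a z + I * t :=
    Filter.eventuallyEq_of_mem (isOpen_D1.mem_nhds hz) fun z hz => H_Phi ha t hz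
  have heq := hd1.unique (hd2.congr_of_eventuallyEq he)
  have h1 := wt_H ha hz
  have h2 := wt_H ha hw
  have hre : (Hc a (Phi a t z)).re = (Hc a z).re := by rw [H_Phi ha t hz]; simp
  rw [hre, ← h1, ← heq, norm_mul] at h2
  have h3 : ‖2 * a / (a - Phi a t z) ^ 2‖ ≠ 0 := by
    rw [norm_ne_zero_iff]
    exact div_ne_zero (mul_ne_zero two_ne_zero (a_ne ha)) (pow_ne_zero 2 (sub_ne ha hw))
  have h4 : ‖2 * a / (a - Phi a t z) ^ 2‖ * ((1 - ‖z‖ ^ 2) * ‖deriv (Phi a t) z‖) =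
      ‖2 * a / (a - Phi a t z) ^ 2‖ * (1 - ‖Phi a t z‖ ^ 2) := by linarith
  exact mul_left_cancel₀ h3 h4

lemma parab {φ : ℂ → ℂ} {a : ℂ} (hp : IsParabolicAuto φ a) :
    ∃ τ : ℝ, τ ≠ 0 ∧ Set.EqOn φ (Phi a τ) D1 := by
  obtain ⟨⟨lam, p, hlam, hpD, hφ⟩, ha, hfix, hder, huniq⟩ := hp
  have ha0 := a_ne ha
  set c := (starRingEnd ℂ) p with hc
  have hcn : ‖c‖ = ‖p‖ := by rw [hc]; exact RCLike.norm_conj p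
  have hp1 := mem_D1.1 hpD
  have hden : ∀ z : ℂ, ‖z‖ ≤ 1 → 1 - c * z ≠ 0 := by
    intro z hz h
    have h1 : c * z = 1 := (sub_eq_zero.1 h).symm
    have h2 := congrArg norm h1
    rw [norm_mul, norm_one, hcn] at h2
    nlinarith [norm_nonneg z, norm_nonneg p]
  have hda := hden a ha.le
  have E1 : lam * (p - a) = a * (1 - c * a) := by
    have := hφ a
    rw [hfix, eq_div_iff hda] at this
    exact this.symm
  have E2 : lam * (c * p - 1) = (1 - c * a) ^ 2 := by
    have h1 : HasDerivAt φ ((lam * (-1) * (1 - c * a) - lam * (p - a) * (-(c * 1))) /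
        (1 - c * a) ^ 2) a := by
      have h := (((hasDerivAt_id a).const_sub p).const_mul lam).div
        (((hasDerivAt_id a).const_mul c).const_sub 1) hda
      have hf : φ = fun z => lam * (p - z) / (1 - c * z) := funext hφ
      rw [hf]
      exact h
    rw [h1.deriv, div_eq_one_iff_eq (pow_ne_zero 2 hda)] at hder
    linear_combination hder
  have E3 : lam = -(1 - 2 * (c * a)) := by
    apply mul_right_cancel₀ hda
    linear_combination c * E1 - E2
  set q := c * a with hq
  have hqn : ‖q‖ = ‖p‖ := by rw [hq, norm_mul, ha, hcn, mul_one]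
  have hcp : c * p = ((‖p‖ ^ 2 : ℝ) : ℂ) := by
    rw [hc, mul_comm, Complex.mul_conj, Complex.normSq_eq_norm_sq]
  have hN : ‖1 - q‖ ^ 2 = 1 - ‖q‖ ^ 2 := by
    have := congrArg norm E2
    rw [norm_mul, hlam, one_mul, norm_pow, hcp] at this
    rw [← this, hqn]
    have h2 : (((‖p‖ ^ 2 : ℝ) : ℂ) - 1) = ((‖p‖ ^ 2 - 1 : ℝ) : ℂ) := by push_cast; ring
    rw [h2, Complex.norm_real, Real.norm_eq_abs, abs_of_nonpos (by nlinarith [norm_nonneg p])]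
    ring
  have hre : (2 * q / (1 - q)).re = 0 := by
    rw [← Complex.normSq_eq_norm_sq, ← Complex.normSq_eq_norm_sq] at hN
    simp [Complex.normSq_apply] at hN
    rw [Complex.div_re, ← add_div]
    apply div_eq_zero_iff.2
    left
    simp
    nlinarith
  set τ := (2 * q / (1 - q)).im with hτ
  have hIτ : I * (τ : ℂ) = 2 * q / (1 - q) := by
    apply Complex.ext
    · rw [hre]; simp
    · simp [hτ]
  refine ⟨τ, ?_, ?_⟩
  · intro h0
    rw [h0] at hIτ
    simp only [Complex.ofReal_zero, mul_zero] at hIτ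
    have h1 : q = 0 := by
      rcases div_eq_zero_iff.1 hIτ.symm with h | h
      · simpa using h
      · exact absurd h hda
    have h2 : p = 0 := by rw [← norm_eq_zero, ← hqn, h1, norm_zero]
    have h3 : φ 0 = 0 := by rw [hφ, h2]; simp
    exact ha0 (huniq 0 (by simp) h3).symm
  · intro z hz
    have hz1 := hden z (mem_D1.1 hz).le
    have hs := sub_ne ha hz
    rw [hφ z, Phi, Ci, hIτ, Hc]
    have d1 : (a + z) / (a - z) + 2 * q / (1 - q) + 1 =
        2 * a * (1 - c * z) / ((a - z) * (1 - q)) := by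
      rw [eq_div_iff (mul_ne_zero hs hda)]
      field_simp
      rw [hq]; ring
    have d2 : (a + z) / (a - z) + 2 * q / (1 - q) - 1 =
        2 * (z - 2 * q * z + q * a) / ((a - z) * (1 - q)) := by
      rw [eq_div_iff (mul_ne_zero hs hda)]
      field_simp
      ring
    rw [d1, d2]
    have e : lam * (p - z) = z - 2 * q * z + q * a := by
      rw [show lam * (p - z) = lam * (p - a) + lam * (a - z) by ring, E1, E3]; ring
    rw [e]
    field_simp

lemma growth {a : ℂ} {w : ℂ → ℂ} {τ M r B : ℝ} (ha : ‖a‖ = 1) (hτ : τ ≠ 0) (hr : 0 < r)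
    (hM : ∀ z ∈ D1, ‖w z‖ ≤ M) (hB : ∀ z ∈ D1, B < ‖Hc a z‖ → ‖w z‖ ≤ r) :
    ∃ K, ∀ n, ∀ z ∈ D1, ‖wprod w (Phi a τ) n z‖ ≤ K * r ^ n := by
  set q := max M r / r with hq
  have hq1 : 1 ≤ q := by rw [hq, le_div_iff₀ hr, one_mul]; exact le_max_right _ _
  have hq0 : 0 < q := by linarith
  set L := max B 0 / |τ| with hL
  have hτ0 : 0 < |τ| := abs_pos.2 hτ
  have hL0 : 0 ≤ L := by positivity
  let cl : ℝ → ℝ := fun s => max (-L) (min s (L + 1))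
  have hcl1 : ∀ s, cl s ≤ L + 1 := fun s => max_le (by linarith) (min_le_right _ _)
  have hcl2 : ∀ s, -L ≤ cl s := fun s => le_max_left _ _
  let sg : ℂ → ℝ := fun z => (Hc a z).im / τ
  have hsg : ∀ z ∈ D1, sg (Phi a τ z) = sg z + 1 := by
    intro z hz
    simp only [sg]
    rw [H_Phi ha τ hz]
    simp
    field_simp
  refine ⟨q ^ (2 * L + 1), ?_⟩
  suffices h : ∀ n, ∀ z ∈ D1, ‖wprod w (Phi a τ) n z‖ ≤ r ^ n * q ^ (L + 1 - cl (sg z)) by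
    intro n z hz
    refine (h n z hz).trans ?_
    rw [mul_comm]
    gcongr
    linarith [hcl2 (sg z)]
  intro n
  induction n with
  | zero =>
    intro z hz
    simp only [wprod, Finset.range_zero, Finset.prod_empty, norm_one, pow_zero, one_mul]
    exact Real.one_le_rpow hq1 (by linarith [hcl1 (sg z)])
  | succ n ih =>
    intro z hz
    have hz' := (Phi_good ha τ).maps z hz
    have h1 := ih _ hz'
    rw [hsg z hz] at h1
    rw [wprod_succ', norm_mul]
    by_cases hfar : B < ‖Hc a z‖
    · have h2 := hB z hz hfar
      have h3 : cl (sg z) ≤ cl (sg z + 1) := by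
        simp only [cl]; gcongr; linarith
      have h4 : q ^ (L + 1 - cl (sg z + 1)) ≤ q ^ (L + 1 - cl (sg z)) := by
        gcongr
      calc ‖w z‖ * ‖wprod w (Phi a τ) n (Phi a τ z)‖
          ≤ r * (r ^ n * q ^ (L + 1 - cl (sg z))) := by
            apply mul_le_mul h2 _ (norm_nonneg _) hr.le
            exact h1.trans (mul_le_mul_of_nonneg_left h4 (by positivity))
        _ = _ := by ring
    · push Not at hfar
      have h2 : ‖w z‖ ≤ r * q := by
        rw [hq, mul_div_cancel₀ _ hr.ne']; exact (hM z hz).trans (le_max_left _ _)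
      have h5 : |sg z| ≤ L := by
        simp only [sg]
        rw [abs_div, hL]
        gcongr
        exact ((Complex.abs_im_le_norm _).trans hfar).trans (le_max_left _ _)
      have h6 := abs_le.1 h5
      have h3 : cl (sg z + 1) = cl (sg z) + 1 := by
        simp only [cl]
        rw [min_eq_left (by linarith), min_eq_left (by linarith), max_eq_right (by linarith),
          max_eq_right (by linarith)]
      have h4 : q ^ (L + 1 - cl (sg z)) = q * q ^ (L + 1 - cl (sg z + 1)) := by
        rw [h3, ← Real.rpow_one_add' hq0.le]
        · congr 1; ring
        · have := hcl1 (sg z + 1)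
          rw [h3] at this
          linarith
      calc ‖w z‖ * ‖wprod w (Phi a τ) n (Phi a τ z)‖
          ≤ (r * q) * (r ^ n * q ^ (L + 1 - cl (sg z + 1))) :=
            mul_le_mul h2 h1 (norm_nonneg _) (by positivity)
        _ = _ := by rw [h4]; ring
/-! ## Approximate eigenvectors -/

def kf (R s : ℝ) (h : ℂ) : ℂ := h / (h + R) * Complex.exp (-(s * h))

lemma hR_ge {h : ℂ} {R : ℝ} (hh : 0 < h.re) (hR : 0 < R) : R ≤ ‖h + R‖ := by
  have := Complex.re_le_norm (h + R)
  simp at this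
  linarith

lemma hR_ge' {h : ℂ} {R : ℝ} (hh : 0 < h.re) (hR : 0 < R) : ‖h‖ ≤ ‖h + R‖ := by
  apply le_of_sq_le_sq _ (norm_nonneg _)
  rw [← Complex.normSq_eq_norm_sq, ← Complex.normSq_eq_norm_sq]
  simp [Complex.normSq_apply]
  nlinarith

lemma hR_ne {h : ℂ} {R : ℝ} (hh : 0 < h.re) (hR : 0 < R) : h + R ≠ 0 :=
  norm_pos_iff.1 (hR.trans_le (hR_ge hh hR))

lemma kf_deriv {h : ℂ} {R s : ℝ} (hh : 0 < h.re) (hR : 0 < R) :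
    HasDerivAt (kf R s)
      ((R / (h + R) ^ 2 - s * (h / (h + R))) * Complex.exp (-(s * h))) h := by
  have h0 := hR_ne hh hR
  have h1 : HasDerivAt (fun h : ℂ => h / (h + R)) ((1 * (h + R) - h * 1) / (h + R) ^ 2) h :=
    (hasDerivAt_id h).div ((hasDerivAt_id h).add_const _) h0
  have h2 : HasDerivAt (fun h : ℂ => Complex.exp (-(s * h)))
      (Complex.exp (-(s * h)) * (-(s * 1))) h :=
    (((hasDerivAt_id h).const_mul (s : ℂ)).neg).cexp
  have h3 : HasDerivAt (kf R s) ((1 * (h + R) - h * 1) / (h + R) ^ 2 * Complex.exp (-(s * h)) +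
      h / (h + R) * (Complex.exp (-(s * h)) * (-(s * 1)))) h := h1.mul h2
  have e : (R / (h + R) ^ 2 - s * (h / (h + R))) * Complex.exp (-(s * h)) =
      (1 * (h + R) - h * 1) / (h + R) ^ 2 * Complex.exp (-(s * h)) +
      h / (h + R) * (Complex.exp (-(s * h)) * (-(s * 1))) := by
    rw [show (1 * (h + R) - h * 1) = (R : ℂ) by ring]
    ring
  rw [e]
  exact h3

lemma kf_comp {a z : ℂ} {R s : ℝ} (ha : ‖a‖ = 1) (hz : z ∈ D1) (hR : 0 < R) :
    HasDerivAt (fun z => kf R s (Hc a z))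
      ((R / (Hc a z + R) ^ 2 - s * (Hc a z / (Hc a z + R))) * Complex.exp (-(s * Hc a z)) *
        (2 * a / (a - z) ^ 2)) z :=
  HasDerivAt.comp z (kf_deriv (re_H_pos ha hz) hR) (hasDeriv_H ha hz)

lemma norm_exp_le {h : ℂ} {s : ℝ} (hh : 0 < h.re) (hs : 0 < s) :
    ‖Complex.exp (-(s * h))‖ ≤ 1 := by
  rw [Complex.norm_exp]
  simp
  positivity

lemma kf_le {h : ℂ} {R s : ℝ} (hh : 0 < h.re) (hR : 0 < R) (hs : 0 < s) : ‖kf R s h‖ ≤ 1 := by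
  rw [kf, norm_mul, norm_div]
  have h1 : ‖h‖ / ‖h + R‖ ≤ 1 := div_le_one_of_le₀ (hR_ge' hh hR) (norm_nonneg _)
  exact mul_le_one₀ h1 (norm_nonneg _) (norm_exp_le hh hs)

lemma kf_bloch {a : ℂ} {R s : ℝ} (ha : ‖a‖ = 1) (hR : 0 < R) (hs : 0 < s) :
    InBloch (fun z => kf R s (Hc a z)) :=
  (bloch_of_sup (fun _ hz => (kf_comp ha hz hR).differentiableAt.differentiableWithinAt)
    fun _ hz => kf_le (re_H_pos ha hz) hR hs).1

lemma kf_lower {a : ℂ} {R s : ℝ} (ha : ‖a‖ = 1) (hR : 0 < R) (hs : 0 < s) :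
    2 * (s * Real.exp (-s)) ≤ blochNorm (fun z => kf R s (Hc a z)) := by
  have hb := kf_bloch ha hR hs
  let x : ℕ → ℂ := fun n => (1 + I * n + R)⁻¹
  have hx : Tendsto x atTop (nhds 0) := by
    refine squeeze_zero_norm' (a := fun n : ℕ => ((n : ℝ))⁻¹) ?_ tendsto_inv_atTop_nhds_zero_nat
    filter_upwards [eventually_gt_atTop 0] with n hn
    simp only [x]
    rw [norm_inv]
    have hn' : (0 : ℝ) < n := by exact_mod_cast hn
    gcongr
    have := Complex.abs_im_le_norm (1 + I * n + R)
    simpa using this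
  have ht : Tendsto (fun n => 2 * (Real.exp (-s) * ‖R * x n ^ 2 - s * (1 - R * x n)‖)) atTop
      (nhds (2 * (Real.exp (-s) * ‖(R : ℂ) * 0 ^ 2 - s * (1 - R * 0)‖))) := by
    exact (((((hx.pow 2).const_mul (R : ℂ)).sub
      (((hx.const_mul (R : ℂ)).const_sub 1).const_mul (s : ℂ))).norm).const_mul _).const_mul 2
  have hlim : 2 * (Real.exp (-s) * ‖(R : ℂ) * 0 ^ 2 - s * (1 - R * 0)‖) =
      2 * (s * Real.exp (-s)) := by
    simp [abs_of_pos hs]; ring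
  rw [hlim] at ht
  refine le_of_tendsto' ht fun n => ?_
  set h : ℂ := 1 + I * n with hh
  have hre : h.re = 1 := by simp [hh]
  have hre0 : 0 < h.re := by rw [hre]; norm_num
  have hz := Ci_mem ha hre0
  have h1 := semi_bound hb hz
  rw [(kf_comp ha hz hR).deriv, norm_mul, norm_mul, H_Ci ha hre0] at h1
  have h2 := wt_H ha hz
  rw [H_Ci ha hre0, hre] at h2
  have h3 : ‖Complex.exp (-(s * h))‖ = Real.exp (-s) := by
    rw [Complex.norm_exp]; simp [hre]
  have h4 : (R / (h + R) ^ 2 - s * (h / (h + R)) : ℂ) = R * x n ^ 2 - s * (1 - R * x n) := by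
    have h0 := hR_ne hre0 hR
    simp only [x]
    rw [← hh]
    field_simp
    ring
  rw [h3, h4] at h1
  refine le_trans (le_of_eq ?_) (h1.trans (semi_le_norm _))
  linear_combination (-Real.exp (-s) * ‖R * x n ^ 2 - s * (1 - R * x n)‖) * h2

lemma circle_sub {a u0 : ℂ} {u : ℂ → ℂ} {τ M s : ℝ} (ha : ‖a‖ = 1)
    (hM : ∀ z ∈ D1, ‖u z‖ ≤ M) (hs : 0 < s)
    (hcont : ∀ ε > 0, ∃ B : ℝ, ∀ z ∈ D1, B < ‖Hc a z‖ → ‖u z - u0‖ ≤ ε)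
    (lam : ℂ) (hlam : lam = u0 * Complex.exp (-(s * (I * τ)))) (hu : AnalyticOnD u) :
    ¬ InvertibleOnBloch (fun f z => lam * f z - wco u (Phi a τ) f z) := by
  rintro ⟨-, S, ⟨C, hC⟩, hS⟩
  set κ := s * Real.exp (-s) with hκ
  have hκ0 : 0 < κ := by positivity
  set ε := κ / (6 * (|C| + 1)) with hε
  have hε0 : 0 < ε := by positivity
  have hM0 : 0 ≤ M := (norm_nonneg _).trans (hM 0 zero_mem_D1)
  obtain ⟨B, hB⟩ := hcont ε hε0
  set A := (M + ‖u0‖) * |B| + M * |τ| with hA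
  have hA0 : 0 ≤ A := by positivity
  set R := A / ε + 1 with hRdef
  have hR : 0 < R := by positivity
  have hAR : A / R ≤ ε := by
    rw [div_le_iff₀ hR, hRdef]
    have : ε * (A / ε) = A := by field_simp
    nlinarith
  set f : ℂ → ℂ := fun z => kf R s (Hc a z) with hf
  have hfb : InBloch f := kf_bloch ha hR hs
  have hφ := Phi_good ha τ
  have hsup : ∀ z ∈ D1, ‖lam * f z - wco u (Phi a τ) f z‖ ≤ 2 * ε := by
    intro z hz
    set h := Hc a z with hh
    have hre : 0 < h.re := re_H_pos ha hz
    have hre' : 0 < (h + I * τ).re := Phi_re ha τ hz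
    have n1 := hR_ne hre hR
    have n2 := hR_ne hre' hR
    have he : lam * f z - wco u (Phi a τ) f z =
        Complex.exp (-(s * (I * τ))) * Complex.exp (-(s * h)) *
          ((u0 - u z) * (h / (h + R)) +
            -(u z * (I * τ * R / ((h + R) * (h + I * τ + R))))) := by
      simp only [hf, wco, kf]
      rw [H_Phi ha τ hz, ← hh, hlam,
        show -(s * (h + I * τ)) = -(s * (I * τ)) + -(s * h) by ring, Complex.exp_add]
      field_simp
      ring
    rw [he, norm_mul, norm_mul]
    have e1 : ‖Complex.exp (-(s * (I * τ)))‖ = 1 := by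
      rw [Complex.norm_exp]; simp
    rw [e1, one_mul]
    have e2 := norm_exp_le hre hs
    have e3 := hR_ge hre hR
    have e4 := hR_ge hre' hR
    have t2 : ‖-(u z * (I * τ * R / ((h + R) * (h + I * τ + R))))‖ ≤ M * |τ| / R := by
      rw [norm_neg, norm_mul, norm_div, norm_mul, norm_mul, norm_mul, Complex.norm_I,
        Complex.norm_real, Complex.norm_real, one_mul, Real.norm_eq_abs, Real.norm_eq_abs,
        abs_of_pos hR, mul_div_assoc M]
      refine mul_le_mul (hM z hz) ?_ (by positivity) hM0
      have : R * R ≤ ‖h + R‖ * ‖h + I * τ + R‖ :=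
        mul_le_mul e3 e4 hR.le (norm_nonneg _)
      rw [div_le_div_iff₀ (mul_pos (hR.trans_le e3) (hR.trans_le e4)) hR, mul_assoc]
      exact mul_le_mul_of_nonneg_left this (abs_nonneg τ)
    have t1 : ‖(u0 - u z) * (h / (h + R))‖ ≤ ε + (M + ‖u0‖) * |B| / R := by
      rw [norm_mul, norm_div]
      by_cases hfar : B < ‖h‖
      · have h1 := hB z hz hfar
        rw [norm_sub_rev] at h1
        have h2 : ‖h‖ / ‖h + R‖ ≤ 1 := div_le_one_of_le₀ (hR_ge' hre hR) (norm_nonneg _)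
        have h3 : 0 ≤ (M + ‖u0‖) * |B| / R := by positivity
        have h4 := mul_le_mul h1 h2 (by positivity) hε0.le
        linarith
      · push Not at hfar
        have h1 : ‖u0 - u z‖ ≤ M + ‖u0‖ := (norm_sub_le _ _).trans (by linarith [hM z hz])
        have h2 : ‖h‖ / ‖h + R‖ ≤ |B| / R :=
          div_le_div₀ (abs_nonneg _) (hfar.trans (le_abs_self _)) hR e3
        have h4 := mul_le_mul h1 h2 (by positivity) (by positivity)
        rw [← mul_div_assoc (M + ‖u0‖)] at h4
        linarith
    have t3 := norm_add_le ((u0 - u z) * (h / (h + R)))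
      (-(u z * (I * τ * R / ((h + R) * (h + I * τ + R)))))
    have t4 : (M + ‖u0‖) * |B| / R + M * |τ| / R = A / R := by rw [← add_div]
    refine (mul_le_of_le_one_left (norm_nonneg _) e2).trans ?_
    linarith
  have hgan : AnalyticOnD (fun z => lam * f z - wco u (Phi a τ) f z) :=
    (hfb.1.const_mul lam).sub (hu.mul (comp_diff hφ hfb.1))
  obtain ⟨g1, g2⟩ := bloch_of_sup hgan hsup
  have h1 := (hC _ g1).2
  rw [norm_congr (hS f hfb).1] at h1
  have h2 := kf_lower ha hR hs
  have h3 : C * blochNorm (fun z => lam * f z - wco u (Phi a τ) f z) ≤ |C| * (3 * (2 * ε)) :=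
    (mul_le_mul_of_nonneg_right (le_abs_self C) (bnorm_nonneg g1)).trans
      (mul_le_mul_of_nonneg_left g2 (abs_nonneg C))
  have h4 : |C| * (3 * (2 * ε)) ≤ κ := by
    have : 6 * (|C| + 1) * ε = κ := by rw [hε]; field_simp
    nlinarith
  have : 2 * κ ≤ κ := h2.trans (h1.trans (h3.trans h4))
  linarith

lemma hcont_of {a : ℂ} {u : ℂ → ℂ} (ha : ‖a‖ = 1)
    (hu : ContinuousOn u (Metric.closedBall 0 1)) :
    ∀ ε > 0, ∃ B : ℝ, ∀ z ∈ D1, B < ‖Hc a z‖ → ‖u z - u a‖ ≤ ε := by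
  intro ε hε
  have h1 := hu a (by simp [ha])
  rw [Metric.continuousWithinAt_iff] at h1
  obtain ⟨η, hη, h⟩ := h1 ε hε
  refine ⟨2 / η, fun z hz hlt => ?_⟩
  have hz1 := mem_D1.1 hz
  rw [← dist_eq_norm]
  refine (h (by simpa using hz1.le) ?_).le
  rw [dist_comm, dist_eq_norm]
  have h0 : 0 < ‖a - z‖ := norm_pos_iff.2 (sub_ne ha hz)
  rw [Hc, norm_div, div_lt_div_iff₀ hη h0] at hlt
  have h2 := norm_add_le a z
  nlinarith

/-! ## Final assembly -/

lemma inv_of_inj {T S : (ℂ → ℂ) → (ℂ → ℂ)} (hT : BddOnBloch T) (hS : BddOnBloch S)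
    (hlin : ∀ f g, Set.EqOn (T (fun z => 1 * f z + (-1) * g z)) (fun z => T f z - T g z) D1)
    (hTS : ∀ f, InBloch f → Set.EqOn (T (S f)) f D1)
    (hinj : ∀ f, InBloch f → Set.EqOn (T f) (fun _ => 0) D1 → Set.EqOn f (fun _ => 0) D1) :
    InvertibleOnBloch T := by
  refine ⟨hT, S, hS, fun f hf => ⟨?_, hTS f hf⟩⟩
  obtain ⟨C, hC⟩ := hT
  obtain ⟨C', hC'⟩ := hS
  have h1 := (hC f hf).1
  have h2 := (hC' _ h1).1
  intro z hz
  have h3 := hinj _ (bloch_add 1 (-1) h2 hf).1 (by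
    intro w hw
    rw [hlin _ _ hw]
    simp only
    rw [hTS _ h1 hw, sub_self]) hz
  simp only at h3
  linear_combination h3

lemma inner_case {a lam : ℂ} {u : ℂ → ℂ} {τ M δ : ℝ} (ha : ‖a‖ = 1) (hτ : τ ≠ 0)
    (hu : AnalyticOnD u) (hM : ∀ z ∈ D1, ‖u z‖ ≤ M) (hδ : 0 < δ) (hd : ∀ z ∈ D1, δ ≤ ‖u z‖)
    (hcont : ∀ ε > 0, ∃ B : ℝ, ∀ z ∈ D1, B < ‖Hc a z‖ → ‖u z - u a‖ ≤ ε)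
    (hinv : InvertibleOnBloch (wco u (Phi a τ))) (hlam : ‖lam‖ < ‖u a‖) :
    InvertibleOnBloch (fun f z => lam * f z - wco u (Phi a τ) f z) := by
  have hφ := Phi_good ha τ
  have hψ := Phi_good ha (-τ)
  have hψφ : ∀ z ∈ D1, Phi a (-τ) (Phi a τ z) = z := fun z hz => Phi_Phi ha _ _ (by ring) hz
  have hφψ : ∀ z ∈ D1, Phi a τ (Phi a (-τ) z) = z := fun z hz => Phi_Phi ha _ _ (by ring) hz
  have hu0 : ∀ z ∈ D1, u z ≠ 0 := fun z hz => norm_pos_iff.1 (hδ.trans_le (hd z hz))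
  obtain ⟨⟨CT, hCT⟩, S, ⟨C, hC⟩, hS⟩ := hinv
  set v : ℂ → ℂ := fun z => (u (Phi a (-τ) z))⁻¹ with hv
  have hSv : ∀ f, InBloch f → Set.EqOn (S f) (wco v (Phi a (-τ)) f) D1 := by
    intro f hf z hz
    have h1 := (hS f hf).2 (hψ.maps z hz)
    simp only [wco, hφψ z hz] at h1
    simp only [wco, hv]
    rw [← h1, inv_mul_cancel_left₀ (hu0 _ (hψ.maps z hz))]
  have hvb : BddOnBloch (wco v (Phi a (-τ))) :=
    ⟨C, fun f hf => ⟨inBloch_congr (hSv f hf) (hC f hf).1, by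
      rw [← norm_congr (hSv f hf)]; exact (hC f hf).2⟩⟩
  have hTV : ∀ g : ℂ → ℂ, ∀ z ∈ D1, wco u (Phi a τ) (wco v (Phi a (-τ)) g) z = g z := by
    intro g z hz
    simp only [wco, hv, hψφ z hz]
    rw [mul_inv_cancel_left₀ (hu0 z hz)]
  have hTb : BddOnBloch (fun f z => lam * f z - wco u (Phi a τ) f z) := by
    refine ⟨‖lam‖ + CT, fun f hf => ?_⟩
    have h1 := bloch_add lam (-1) hf (hCT f hf).1
    have he : (fun z => lam * f z + -1 * wco u (Phi a τ) f z) =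
        fun z => lam * f z - wco u (Phi a τ) f z := by
      funext z; ring
    rw [he] at h1
    refine ⟨h1.1, h1.2.trans ?_⟩
    have := (hCT f hf).2
    simp only [norm_neg, norm_one]
    linarith
  have hlin : ∀ f g : ℂ → ℂ, Set.EqOn
      ((fun f z => lam * f z - wco u (Phi a τ) f z) (fun z => 1 * f z + (-1) * g z))
      (fun z => (fun f z => lam * f z - wco u (Phi a τ) f z) f z -
        (fun f z => lam * f z - wco u (Phi a τ) f z) g z) D1 := by
    intro f g z hz; simp only [wco]; ring
  have hneg : ∀ (c : ℂ) (W : (ℂ → ℂ) → (ℂ → ℂ)), BddOnBloch W →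
      BddOnBloch (fun f z => c * W f z) := by
    rintro c W ⟨D, hD⟩
    refine ⟨‖c‖ * D, fun f hf => ?_⟩
    have h1 := bloch_add c 0 (hD f hf).1 hf
    simp only [zero_mul, add_zero, norm_zero] at h1
    refine ⟨h1.1, h1.2.trans ?_⟩
    rw [mul_assoc]
    exact mul_le_mul_of_nonneg_left (hD f hf).2 (norm_nonneg c)
  by_cases hl : lam = 0
  · subst hl
    refine inv_of_inj hTb (hneg (-1) _ hvb) hlin ?_ ?_
    · intro f hf z hz
      have h1 := hTV f z hz
      simp only [wco] at h1 ⊢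
      linear_combination h1
    · intro f hf h0 z hz
      have h1 := h0 (hψ.maps z hz)
      simp only [wco, hφψ z hz, zero_mul, zero_sub, neg_eq_zero] at h1
      exact (mul_eq_zero.1 h1).resolve_left (hu0 _ (hψ.maps z hz))
  have hl0 : 0 < ‖lam‖ := norm_pos_iff.2 hl
  -- resolvent of the inverse
  obtain ⟨r, hr1, hr2⟩ := exists_between hlam
  have hr0 : 0 < r := hl0.trans hr1
  obtain ⟨B, hB⟩ := hcont (‖u a‖ - r) (by linarith)
  have hvM : ∀ z ∈ D1, ‖v z‖ ≤ δ⁻¹ := by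
    intro z hz
    rw [hv, norm_inv]
    exact inv_anti₀ hδ (hd _ (hψ.maps z hz))
  have hM0 : 0 < M := hδ.trans_le ((hd 0 zero_mem_D1).trans (hM 0 zero_mem_D1))
  have hvd : ∀ z ∈ D1, M⁻¹ ≤ ‖v z‖ := by
    intro z hz
    rw [hv, norm_inv]
    exact inv_anti₀ (hδ.trans_le (hd _ (hψ.maps z hz))) (hM _ (hψ.maps z hz))
  have hva : AnalyticOnD v :=
    (comp_diff hψ hu).inv fun z hz => hu0 _ (hψ.maps z hz)
  have hvB : ∀ z ∈ D1, B + |τ| < ‖Hc a z‖ → ‖v z‖ ≤ r⁻¹ := by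
    intro z hz hlt
    have h1 := H_Phi ha (-τ) hz
    have h2 : ‖Hc a z‖ ≤ ‖Hc a (Phi a (-τ) z)‖ + |τ| := by
      have h3 : Hc a z = Hc a (Phi a (-τ) z) + I * τ := by rw [h1]; push_cast; ring
      have h4 := norm_add_le (Hc a (Phi a (-τ) z)) (I * τ)
      rw [← h3] at h4
      simpa using h4
    have h5 := hB _ (hψ.maps z hz) (by linarith)
    rw [hv, norm_inv]
    refine inv_anti₀ hr0 ?_
    have h6 : ‖u a‖ ≤ ‖u (Phi a (-τ) z)‖ + ‖u (Phi a (-τ) z) - u a‖ := by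
      have := norm_sub_le (u (Phi a (-τ) z)) (u (Phi a (-τ) z) - u a)
      simpa using this
    linarith
  obtain ⟨K, hK⟩ := growth ha (neg_ne_zero.2 hτ) (inv_pos.2 hr0) hvM hvB
  have hres := neumann (lam := lam⁻¹) hψ hva hvM (inv_pos.2 hM0) hvd hvb (inv_pos.2 hr0).le hK
    (by rw [norm_inv]; exact inv_strictAnti₀ hl0 hr1)
  obtain ⟨⟨C1, hC1⟩, Q, ⟨CQ, hCQ⟩, hQ⟩ := hres
  obtain ⟨CV, hCV⟩ := hvb
  have hVQ : BddOnBloch (fun f => wco v (Phi a (-τ)) (Q f)) := by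
    refine ⟨|CV| * |CQ|, fun f hf => ?_⟩
    obtain ⟨q1, q2⟩ := hCQ f hf
    obtain ⟨v1, v2⟩ := hCV _ q1
    refine ⟨v1, ?_⟩
    have hfn := bnorm_nonneg hf
    calc _ ≤ |CV| * blochNorm (Q f) :=
          v2.trans (mul_le_mul_of_nonneg_right (le_abs_self _) (bnorm_nonneg q1))
      _ ≤ |CV| * (|CQ| * blochNorm f) := by
          gcongr
          exact q2.trans (mul_le_mul_of_nonneg_right (le_abs_self _) hfn)
      _ = _ := by ring
  refine inv_of_inj hTb (hneg (-lam⁻¹) _ hVQ) hlin ?_ ?_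
  · intro f hf z hz
    have h1 := hTV (Q f) z hz
    have h2 := (hQ f hf).2 hz
    simp only [wco] at h1 h2 ⊢
    rw [← h2]
    have h3 : lam * (-lam⁻¹ * (v z * Q f (Phi a (-τ) z))) = -(v z * Q f (Phi a (-τ) z)) := by
      field_simp
    linear_combination h3 + lam⁻¹ * h1
  · intro f hf h0 z hz
    have h1 : Set.EqOn (fun z => lam⁻¹ * f z - wco v (Phi a (-τ)) f z) (fun _ => 0) D1 := by
      intro w hw
      have h2 := h0 (hψ.maps w hw)
      simp only [wco, hφψ w hw, hv] at h2 ⊢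
      have := hu0 _ (hψ.maps w hw)
      field_simp
      linear_combination -h2
    have h7 : blochNorm (fun _ => (0 : ℂ)) = 0 := by simp [blochNorm, blochSemi]
    have h8 := (hCQ _ (hC1 _ hf).1).2
    rw [norm_congr h1, h7, mul_zero, norm_congr (hQ _ hf).1] at h8
    have h9 := (pt_bound' hf hz).trans (div_nonpos_of_nonpos_of_nonneg h8 (wt_pos hz).le)
    exact norm_le_zero_iff.1 h9

/-- spectrum of uC_φ on B, parabolic case, is the circle of radius |u(a)|. -/
theorem stmt_15 (u φ : ℂ → ℂ) (a : ℂ) (hu : InDiscAlgebra u)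
    (hp : IsParabolicAuto φ a) (hinv : InvertibleOnBloch (wco u φ)) :
    blochSpectrum (wco u φ) = {lam : ℂ | ‖lam‖ = ‖u a‖} := by
  have ha : ‖a‖ = 1 := hp.2.1
  obtain ⟨τ, hτ, hφτ⟩ := parab hp
  have hcont := hcont_of ha hu.1
  obtain ⟨M, hM'⟩ := (isCompact_closedBall (0 : ℂ) 1).exists_bound_of_continuousOn hu.1
  have hM : ∀ z ∈ D1, ‖u z‖ ≤ M := fun z hz => hM' z (Metric.ball_subset_closedBall hz)
  have hw : ∀ f, Set.EqOn (wco u φ f) (wco u (Phi a τ) f) D1 := by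
    intro f z hz; simp only [wco]; rw [hφτ hz]
  have hinv' : InvertibleOnBloch (wco u (Phi a τ)) :=
    inv_congr hw (by intro f g z hz; simp only [wco]; ring) hinv
  have hφ := Phi_good ha τ
  obtain ⟨δ, hδ, hd⟩ := lower_bound hφ hinv'
  have hua : u a ≠ 0 := by
    intro h0
    obtain ⟨B, hB⟩ := hcont (δ / 2) (by linarith)
    have hre : 0 < ((1 + |B| : ℝ) : ℂ).re := by
      rw [Complex.ofReal_re]; positivity
    have hz := Ci_mem ha hre
    have h1 := hB _ hz (by
      rw [H_Ci ha hre, Complex.norm_real, Real.norm_eq_abs, abs_of_pos (by positivity)]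
      linarith [le_abs_self B])
    rw [h0, sub_zero] at h1
    linarith [hd _ hz]
  have hua0 : 0 < ‖u a‖ := norm_pos_iff.2 hua
  ext lam
  simp only [blochSpectrum, Set.mem_setOf_eq]
  have hiff : InvertibleOnBloch (fun f z => lam * f z - wco u φ f z) ↔
      InvertibleOnBloch (fun f z => lam * f z - wco u (Phi a τ) f z) := by
    constructor
    · refine inv_congr (fun f z hz => ?_) (fun f g z hz => ?_)
      · simp only [hw f hz]
      · simp only [wco]; ring
    · refine inv_congr (fun f z hz => ?_) (fun f g z hz => ?_)
      · simp only [hw f hz]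
      · simp only [wco]; ring
  rw [hiff]
  constructor
  · intro hnot
    by_contra hne
    apply hnot
    rcases lt_or_gt_of_ne hne with hlt | hgt
    · exact inner_case ha hτ hu.2 hM hδ hd hcont hinv' hlt
    · obtain ⟨r, hr1, hr2⟩ := exists_between hgt
      obtain ⟨B, hB⟩ := hcont (r - ‖u a‖) (by linarith)
      obtain ⟨K, hK⟩ := growth ha hτ (hua0.trans hr1) hM (B := B) (fun z hz hlt => by
        have h1 := hB z hz hlt
        have h2 : ‖u z‖ ≤ ‖u z - u a‖ + ‖u a‖ := by simpa using norm_add_le (u z - u a) (u a)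
        linarith)
      exact neumann hφ hu.2 hM hδ hd hinv'.1 (hua0.trans hr1).le hK hr2
  · intro heq
    have hn : ‖lam / u a‖ = 1 := by rw [norm_div, heq, div_self hua0.ne']
    obtain ⟨θ, hθ⟩ := (Complex.norm_eq_one_iff _).1 hn
    -- choose s > 0 with -s τ ≡ θ mod 2π
    obtain ⟨s, hs, k, hk⟩ : ∃ s : ℝ, 0 < s ∧ ∃ k : ℤ, -(s * τ) = θ + k * (2 * Real.pi) := by
      obtain ⟨n, hn⟩ := exists_nat_gt (|θ| / (2 * Real.pi))
      have hpi := Real.pi_pos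
      rw [div_lt_iff₀ (by positivity)] at hn
      have h1 := abs_le.1 (le_refl |θ|)
      rcases lt_or_gt_of_ne hτ with h | h
      · refine ⟨(θ + n * (2 * Real.pi)) / (-τ), div_pos (by linarith) (by linarith), n, ?_⟩
        push_cast; field_simp
      · refine ⟨(-θ + n * (2 * Real.pi)) / τ, div_pos (by linarith) h, -n, ?_⟩
        push_cast; field_simp; ring
    refine circle_sub ha hM hs hcont lam ?_ hu.2
    have h1 : (-(s * (I * τ)) : ℂ) = θ * I + k * (2 * Real.pi * I) := by
      have : ((-(s * τ) : ℝ) : ℂ) = ((θ + k * (2 * Real.pi) : ℝ) : ℂ) := by rw [hk]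
      push_cast at this
      linear_combination I * this
    rw [h1, Complex.exp_add, Complex.exp_int_mul_two_pi_mul_I, mul_one, hθ]
    field_simp
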